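/- For p prime, k ≥ 1, d ≥ 1, the number of separable polynomials f ∈ (ℤ/p^k)[x] with deg(f) ≤ d (arbitrary leading coefficient) is φ(p^k)·p^{(k-1)d}·(p^d + 1). -/

import Mathlib

open TensorProduct Polynomial

/-- An `R`-algebra `A` is separable if `A` is projective as a module over the
enveloping algebra `A ⊗[R] A` (for commutative `A`, which acts via multiplication). -/
def IsSeparableAlgebra (R A : Type*) [CommRing R] [CommRing A] [Algebra R A] : Prop :=
  letI : Module (A ⊗[R] A) A :=
    Module.compHom A (Algebra.TensorProduct.lmul' (S := A) R).toRingHom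
  Module.Projective (A ⊗[R] A) A

/-- A polynomial `f ∈ R[x]` is separable if `R[x]/(f)` is a separable `R`-algebra. -/
def Polynomial.IsSeparablePoly {R : Type*} [CommRing R] (f : R[X]) : Prop :=
  IsSeparableAlgebra R (AdjoinRoot f)

theorem isSeparableAlgebra_iff_formallyUnramified {R A : Type*} [CommRing R] [CommRing A]
    [Algebra R A] [Algebra.EssFiniteType R A] :
    IsSeparableAlgebra R A ↔ Algebra.FormallyUnramified R A := by
  rw [Algebra.FormallyUnramified.iff_exists_tensorProduct, IsSeparableAlgebra]
  let : Module (A ⊗[R] A) A :=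
    Module.compHom A (Algebra.TensorProduct.lmul' (S := A) R).toRingHom
  have smul_def (u : A ⊗[R] A) (a : A) : u • a = Algebra.TensorProduct.lmul' R u * a := rfl
  let μ : A ⊗[R] A →ₗ[A ⊗[R] A] A := LinearMap.toSpanSingleton _ A 1
  have μ_apply (u : A ⊗[R] A) : μ u = Algebra.TensorProduct.lmul' R u := by
    simp [μ, LinearMap.toSpanSingleton_apply, smul_def]
  constructor
  · intro h
    obtain ⟨s, hs⟩ := Module.projective_lifting_property μ LinearMap.id
      fun a ↦ ⟨a ⊗ₜ 1, by simp [μ_apply]⟩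
    refine ⟨s 1, fun a ↦ ?_, ?_⟩
    · rw [← smul_eq_mul, ← map_smul, smul_def]
      simp
    · rw [← μ_apply]
      exact LinearMap.congr_fun hs 1
  · rintro ⟨t, ht, ht'⟩
    have key (u : A ⊗[R] A) : u * t = (Algebra.TensorProduct.lmul' R u ⊗ₜ[R] (1 : A)) * t := by
      induction u with
      | zero => simp
      | add x y hx hy => simp [add_mul, hx, hy, TensorProduct.add_tmul]
      | tmul x y =>
        have := ht y
        rw [sub_mul, sub_eq_zero] at this
        calc x ⊗ₜ[R] y * t = x ⊗ₜ[R] (1 : A) * ((1 : A) ⊗ₜ[R] y * t) := by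
              rw [← mul_assoc]; simp
          _ = _ := by rw [this, ← mul_assoc]; simp
    let i : A →ₗ[A ⊗[R] A] A ⊗[R] A :=
      { toFun := fun a ↦ (a ⊗ₜ[R] (1 : A)) * t
        map_add' := fun a b ↦ by simp [TensorProduct.add_tmul, add_mul]
        map_smul' := fun u a ↦ by
          rw [RingHom.id_apply, smul_eq_mul, mul_left_comm, key u, smul_def, ← mul_assoc,
            Algebra.TensorProduct.tmul_mul_tmul, mul_one, mul_comm a] }
    refine Module.Projective.of_split i μ (LinearMap.ext fun a ↦ ?_)
    change μ (a ⊗ₜ[R] (1 : A) * t) = a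
    simp [μ_apply, ht']

theorem AdjoinRoot.formallyUnramified_iff_separable {R : Type*} [CommRing R] (f : R[X]) :
    Algebra.FormallyUnramified R (AdjoinRoot f) ↔ f.Separable := by
  have isUnit_iff : IsUnit (AdjoinRoot.mk f (derivative f)) ↔ f.Separable := by
    rw [isUnit_iff_exists_inv, Polynomial.separable_def']
    constructor
    · rintro ⟨b, hb⟩
      obtain ⟨g, rfl⟩ := AdjoinRoot.mk_surjective b
      rw [← map_mul, ← map_one (AdjoinRoot.mk f), AdjoinRoot.mk_eq_mk] at hb
      obtain ⟨c, hc⟩ := hb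
      exact ⟨-c, g, by linear_combination hc⟩
    · rintro ⟨a, b, hab⟩
      exact ⟨AdjoinRoot.mk f b, by
        rw [← map_mul, ← map_one (AdjoinRoot.mk f), AdjoinRoot.mk_eq_mk]
        exact ⟨-a, by linear_combination hab⟩⟩
  rw [← isUnit_iff]
  constructor
  · intro h
    let B := AdjoinRoot f ⧸ Ideal.span {AdjoinRoot.mk f (derivative f)}
    let x : B := Ideal.Quotient.mk _ (AdjoinRoot.root f)
    have aeval_x (g : R[X]) : aeval x g = (Ideal.Quotient.mk _ (AdjoinRoot.mk f g) : B) := by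
      rw [← AdjoinRoot.aeval_eq g]
      exact Polynomial.aeval_algHom_apply (Ideal.Quotient.mkₐ R _) (AdjoinRoot.root f) g
    let y : DualNumber B := algebraMap B (DualNumber B) x
    have aeval_y (g : R[X]) : aeval y g = algebraMap B (DualNumber B) (aeval x g) :=
      Polynomial.aeval_algebraMap_apply _ _ _
    have aeval_f : aeval y f = 0 := by simp [aeval_y, aeval_x]
    have aeval_derivative : aeval y (derivative f) = 0 := by
      rw [aeval_y, aeval_x, Ideal.Quotient.eq_zero_iff_mem.mpr (Ideal.mem_span_singleton_self _),
        map_zero]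
    have aeval_f' : aeval (y + DualNumber.eps) f = 0 := by
      rw [Polynomial.aeval_add_of_sq_eq_zero _ _ _ (by rw [sq, DualNumber.eps_mul_eps]), aeval_f,
        aeval_derivative, zero_mul, zero_add]
    let g₁ := AdjoinRoot.liftAlgHom f (Algebra.ofId R (DualNumber B)) y aeval_f
    let g₂ := AdjoinRoot.liftAlgHom f (Algebra.ofId R (DualNumber B)) (y + DualNumber.eps) aeval_f'
    have g₁_root : g₁ (AdjoinRoot.root f) = y := AdjoinRoot.liftAlgHom_root _ _ _ _
    have g₂_root : g₂ (AdjoinRoot.root f) = y + DualNumber.eps :=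
      AdjoinRoot.liftAlgHom_root _ _ _ _
    have hker : IsNilpotent (RingHom.ker (TrivSqZeroExt.fstHom R B B : DualNumber B →+* B)) :=
      ⟨2, TrivSqZeroExt.kerIdeal_sq B B⟩
    have heq : g₁ = g₂ := by
      refine Algebra.FormallyUnramified.lift_unique' (TrivSqZeroExt.fstHom R B B) hker _ _ ?_
      apply AdjoinRoot.algHom_ext
      simp [g₁_root, g₂_root]
    have hone : (1 : B) = 0 := by
      have := congrArg TrivSqZeroExt.snd (AlgHom.congr_fun heq (AdjoinRoot.root f))
      simpa [g₁_root, g₂_root, y, TrivSqZeroExt.algebraMap_eq_inl] using this.symm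
    rw [← map_one (Ideal.Quotient.mk _), Ideal.Quotient.eq_zero_iff_mem,
      Ideal.mem_span_singleton] at hone
    exact isUnit_of_dvd_one hone
  · intro hu
    rw [Algebra.FormallyUnramified.iff_comp_injective]
    intro B _ _ I hI g₁ g₂ hg
    apply AdjoinRoot.algHom_ext
    set x := g₁ (AdjoinRoot.root f)
    set y := g₂ (AdjoinRoot.root f)
    have hmem : x - y ∈ I := by
      rw [← Ideal.Quotient.eq]
      exact AlgHom.congr_fun hg (AdjoinRoot.root f)
    have hsq : (x - y) ^ 2 = 0 := by
      rw [← Ideal.mem_bot, ← hI]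
      exact Ideal.pow_mem_pow hmem 2
    have aeval_y (g : R[X]) : aeval y g = g₂ (AdjoinRoot.mk f g) := by
      rw [Polynomial.aeval_algHom_apply, AdjoinRoot.aeval_eq]
    have hx : aeval x f = 0 := by
      rw [Polynomial.aeval_algHom_apply, AdjoinRoot.aeval_eq, AdjoinRoot.mk_self, map_zero]
    have hexp := Polynomial.aeval_add_of_sq_eq_zero f y (x - y) hsq
    rw [add_sub_cancel, hx, aeval_y, aeval_y, AdjoinRoot.mk_self, map_zero, zero_add] at hexp
    exact sub_eq_zero.mp ((hu.map g₂).mul_right_eq_zero.mp hexp.symm)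

theorem Polynomial.separable_map_iff_of_ker_le_nilradical {R S : Type*} [CommRing R] [CommRing S]
    (φ : R →+* S) (hφ : Function.Surjective φ) (hker : RingHom.ker φ ≤ nilradical R) (f : R[X]) :
    (f.map φ).Separable ↔ f.Separable := by
  refine ⟨fun ⟨a, b, hab⟩ ↦ ?_, fun h ↦ h.map⟩
  obtain ⟨a, rfl⟩ := Polynomial.map_surjective φ hφ a
  obtain ⟨b, rfl⟩ := Polynomial.map_surjective φ hφ b
  have hn : IsNilpotent (a * f + b * derivative f - 1) := by
    rw [Polynomial.isNilpotent_iff]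
    intro i
    apply hker
    rw [RingHom.mem_ker, ← Polynomial.coeff_map]
    simp [← hab]
  have hu : IsUnit (a * f + b * derivative f) := by
    simpa using hn.isUnit_add_one
  obtain ⟨c, hc⟩ := hu.exists_left_inv
  exact ⟨c * a, c * b, by linear_combination hc⟩

theorem AddMonoidHom.card_preimage_eq_card_mul_card_ker {G H : Type*} [AddGroup G] [AddGroup H]
    (ψ : G →+ H) (hψ : Function.Surjective ψ) (T : Set H) :
    Nat.card (ψ ⁻¹' T) = Nat.card T * Nat.card ψ.ker := by
  obtain ⟨s, hs⟩ := hψ.hasRightInverse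
  rw [← Nat.card_prod]
  exact Nat.card_congr
    { toFun := fun x ↦ (⟨ψ x, x.2⟩, ⟨x - s (ψ x), by simp [AddMonoidHom.mem_ker, hs (ψ x)]⟩)
      invFun := fun y ↦ ⟨y.2 + s y.1, by
        simp [AddMonoidHom.mem_ker.mp y.2.2, hs y.1.1]⟩
      left_inv := fun x ↦ by simp
      right_inv := fun y ↦ by
        ext <;> simp [AddMonoidHom.mem_ker.mp y.2.2, hs y.1.1] }

namespace Polynomial

theorem mem_degreeLT_succ_iff {R : Type*} [Semiring R] {d : ℕ} {f : R[X]} :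
    f ∈ degreeLT R (d + 1) ↔ f.natDegree ≤ d := by
  rw [mem_degreeLT, degree_lt_iff_coeff_zero, natDegree_le_iff_coeff_eq_zero]
  rfl

theorem card_degreeLT (R : Type*) [Semiring R] (n : ℕ) :
    Nat.card (degreeLT R n) = Nat.card R ^ n := by
  rw [Nat.card_congr (degreeLTEquiv R n).toEquiv, Nat.card_fun, Nat.card_fin]

theorem card_natDegree_le (R : Type*) [Semiring R] (d : ℕ) :
    Nat.card {f : R[X] | f.natDegree ≤ d} = Nat.card R ^ (d + 1) := by
  rw [← card_degreeLT]
  exact Nat.card_congr (Equiv.subtypeEquivRight fun f ↦ mem_degreeLT_succ_iff.symm)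

theorem finite_natDegree_le (R : Type*) [Semiring R] [Finite R] (d : ℕ) :
    {f : R[X] | f.natDegree ≤ d}.Finite :=
  Nat.finite_of_card_ne_zero (by
    rw [card_natDegree_le]
    exact pow_ne_zero _ Nat.card_pos.ne')

theorem card_natDegree_le_map_mul {R S : Type*} [Ring R] [Ring S] [Finite R]
    (φ : R →+* S) (hφ : Function.Surjective φ) (d : ℕ) (P : S[X] → Prop) :
    Nat.card {f : R[X] | f.natDegree ≤ d ∧ P (f.map φ)} * Nat.card S ^ (d + 1) =
      Nat.card {f : S[X] | f.natDegree ≤ d ∧ P f} * Nat.card R ^ (d + 1) := by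
  let ψ : degreeLT R (d + 1) →+ degreeLT S (d + 1) :=
    AddMonoidHom.mk' (fun f ↦ ⟨f.1.map φ, mem_degreeLT_succ_iff.mpr
      (natDegree_map_le.trans (mem_degreeLT_succ_iff.mp f.2))⟩) fun f g ↦ by ext; simp
  have hψ : Function.Surjective ψ := by
    rintro ⟨g, hg⟩
    obtain ⟨f, rfl, hdeg⟩ := exists_natDegree_eq_of_mem_lifts (f := φ)
      ((mem_lifts g).mpr (map_surjective φ hφ g))
    rw [mem_degreeLT_succ_iff, ← hdeg] at hg
    exact ⟨⟨f, mem_degreeLT_succ_iff.mpr hg⟩, rfl⟩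
  let T : Set (degreeLT S (d + 1)) := {f | P f}
  have hT : Nat.card T = Nat.card {f : S[X] | f.natDegree ≤ d ∧ P f} :=
    Nat.card_congr ((Equiv.subtypeSubtypeEquivSubtypeInter _ _).trans
      (Equiv.subtypeEquivRight fun f ↦ and_congr_left' mem_degreeLT_succ_iff))
  have hψT : Nat.card (ψ ⁻¹' T) = Nat.card {f : R[X] | f.natDegree ≤ d ∧ P (f.map φ)} :=
    Nat.card_congr ((Equiv.subtypeSubtypeEquivSubtypeInter (· ∈ degreeLT R (d + 1))
      (fun f ↦ P (f.map φ))).trans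
      (Equiv.subtypeEquivRight fun f ↦ and_congr_left' mem_degreeLT_succ_iff))
  have hcard := ψ.card_preimage_eq_card_mul_card_ker hψ Set.univ
  rw [Set.preimage_univ, Nat.card_univ, Nat.card_univ, card_degreeLT, card_degreeLT] at hcard
  rw [← hψT, ← hT, ψ.card_preimage_eq_card_mul_card_ker hψ, hcard]
  ring

section Squarefree

variable {F : Type*} [Field F]

theorem exists_monic_sq_mul_squarefree {f : F[X]} (hf : f ≠ 0) :
    ∃ g h : F[X], g.Monic ∧ Squarefree h ∧ f = g ^ 2 * h := by
  induction hn : f.natDegree using Nat.strong_induction_on generalizing f with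
  | _ n ih =>
    by_cases hsq : Squarefree f
    · exact ⟨1, f, monic_one, hsq, by simp⟩
    obtain ⟨x, ⟨f', rfl⟩, hx⟩ : ∃ x, x * x ∣ f ∧ ¬IsUnit x := by
      simpa [Squarefree] using hsq
    have hx0 : x ≠ 0 := by rintro rfl; simp at hf
    have hf' : f' ≠ 0 := by rintro rfl; simp at hf
    have hdeg : 0 < x.natDegree := by
      rw [Nat.pos_iff_ne_zero]
      exact fun h ↦ hx (isUnit_iff_degree_eq_zero.mpr (by rw [degree_eq_natDegree hx0, h]; rfl))
    obtain ⟨g, h, hg, hh, rfl⟩ := ih f'.natDegree (by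
      rw [← hn, natDegree_mul (mul_ne_zero hx0 hx0) hf', natDegree_mul hx0 hx0]; omega) hf' rfl
    have hlc : x.leadingCoeff ≠ 0 := leadingCoeff_ne_zero.mpr hx0
    have hu : IsUnit (C (x.leadingCoeff ^ 2)) := by
      rw [isUnit_C]; exact (pow_ne_zero 2 hlc).isUnit
    refine ⟨x * C x.leadingCoeff⁻¹ * g, C (x.leadingCoeff ^ 2) * h,
      (monic_mul_leadingCoeff_inv hx0).mul hg, ?_, ?_⟩
    · exact (associated_unit_mul_right h _ hu).squarefree_iff.mp hh
    · have : C x.leadingCoeff⁻¹ * C x.leadingCoeff = 1 := by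
        rw [← C_mul, inv_mul_cancel₀ hlc, C_1]
      rw [C_pow]
      linear_combination (-(x ^ 2 * g ^ 2 * h) * (C x.leadingCoeff⁻¹ * C x.leadingCoeff + 1)) * this

theorem dvd_of_sq_dvd_sq_mul_squarefree {g₁ g₂ h : F[X]} (hg : g₁ ≠ 0) (hh : Squarefree h)
    (hdvd : g₁ ^ 2 ∣ g₂ ^ 2 * h) : g₁ ∣ g₂ := by
  classical
  let := EuclideanDomain.gcdMonoid F[X]
  obtain ⟨a, b, ha, hb, hab⟩ := extract_gcd g₁ g₂
  rw [gcd_isUnit_iff] at hab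
  set e := gcd g₁ g₂
  have he : e ≠ 0 := left_ne_zero_of_mul (ha ▸ hg)
  rw [ha, hb, mul_pow, mul_pow, mul_assoc, mul_dvd_mul_iff_left (pow_ne_zero 2 he)] at hdvd
  have hua : IsUnit a := hh a (by rw [← sq]; exact hab.pow.dvd_of_dvd_mul_left hdvd)
  rw [ha, hb]
  exact mul_dvd_mul_left e hua.dvd

theorem sq_mul_squarefree_unique {g₁ g₂ h₁ h₂ : F[X]} (hg₁ : g₁.Monic) (hg₂ : g₂.Monic)
    (hh₁ : Squarefree h₁) (hh₂ : Squarefree h₂) (heq : g₁ ^ 2 * h₁ = g₂ ^ 2 * h₂) :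
    g₁ = g₂ ∧ h₁ = h₂ := by
  obtain rfl : g₁ = g₂ := eq_of_monic_of_associated hg₁ hg₂ (associated_of_dvd_dvd
    (dvd_of_sq_dvd_sq_mul_squarefree hg₁.ne_zero hh₂ ⟨h₁, heq.symm⟩)
    (dvd_of_sq_dvd_sq_mul_squarefree hg₂.ne_zero hh₁ ⟨h₂, heq⟩))
  exact ⟨rfl, mul_left_cancel₀ (pow_ne_zero 2 hg₁.ne_zero) heq⟩

theorem exists_eq_X_mul_add_C_sq_mul {f : F[X]} (hf : f ≠ 0) (hsq : ¬Squarefree f) :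
    ∃ (c : F) (g h : F[X]), g.Monic ∧ Squarefree h ∧ f = (g * X + C c) ^ 2 * h := by
  obtain ⟨G, h, hG, hh, rfl⟩ := exists_monic_sq_mul_squarefree hf
  have hdeg : G.natDegree ≠ 0 := by
    intro h0
    rw [hG.natDegree_eq_zero.mp h0] at hsq
    simp [hh] at hsq
  refine ⟨G.coeff 0, G.divX, h, ?_, hh, by rw [divX_mul_X_add]⟩
  rw [Monic, leadingCoeff, natDegree_divX_eq_natDegree_tsub_one, coeff_divX,
    Nat.sub_add_cancel (Nat.pos_of_ne_zero hdeg), hG.coeff_natDegree]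

theorem Monic.mul_X_add_C {g : F[X]} (hg : g.Monic) (c : F) : (g * X + C c).Monic :=
  (hg.mul monic_X).add_of_left (degree_C_le.trans_lt (by
    rw [Polynomial.degree_mul, degree_X, degree_eq_natDegree hg.ne_zero]
    exact_mod_cast Nat.succ_pos _))

theorem natDegree_mul_X_add_C_sq_mul {g h : F[X]} (hg : g.Monic) (hh : h ≠ 0) (c : F) :
    ((g * X + C c) ^ 2 * h).natDegree = (g ^ 2 * h).natDegree + 2 := by
  rw [(((hg.mul_X_add_C c).pow 2).natDegree_mul' hh), (hg.pow 2).natDegree_mul' hh,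
    natDegree_pow, natDegree_pow, natDegree_add_C, natDegree_mul_X hg.ne_zero]
  ring

theorem card_not_squarefree_natDegree_le (e : ℕ) :
    Nat.card {f : F[X] | f ≠ 0 ∧ ¬Squarefree f ∧ f.natDegree ≤ e + 2} =
      Nat.card F * Nat.card {f : F[X] | f ≠ 0 ∧ f.natDegree ≤ e} := by
  choose g h hg hh hgh using fun f : {f : F[X] // f ≠ 0} ↦ exists_monic_sq_mul_squarefree f.2
  rw [← Nat.card_prod]
  symm
  let Φ (x : F × {f : F[X] | f ≠ 0 ∧ f.natDegree ≤ e}) : F[X] :=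
    (g ⟨x.2, x.2.2.1⟩ * X + C x.1) ^ 2 * h ⟨x.2, x.2.2.1⟩
  have hΦ (x) : Φ x ∈ {f : F[X] | f ≠ 0 ∧ ¬Squarefree f ∧ f.natDegree ≤ e + 2} := by
    obtain ⟨c, f, hf0, hf⟩ := x
    have hmonic := (hg ⟨f, hf0⟩).mul_X_add_C c
    refine ⟨mul_ne_zero (pow_ne_zero 2 hmonic.ne_zero) (hh ⟨f, hf0⟩).ne_zero, fun hsq ↦ ?_, ?_⟩
    · have hu := hsq _ (by rw [← sq]; exact dvd_mul_right _ _)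
      have := natDegree_eq_zero_of_isUnit hu
      rw [natDegree_add_C, natDegree_mul_X (hg _).ne_zero] at this
      omega
    · rw [natDegree_mul_X_add_C_sq_mul (hg _) (hh _).ne_zero, ← hgh]
      exact Nat.add_le_add_right hf 2
  refine Nat.card_congr (Equiv.ofBijective (fun x ↦ (⟨Φ x, hΦ x⟩ : Set.Elem _)) ⟨?_, ?_⟩)
  · rintro ⟨c₁, f₁, hf₁⟩ ⟨c₂, f₂, hf₂⟩ heq
    obtain ⟨hG, hH⟩ := sq_mul_squarefree_unique ((hg _).mul_X_add_C c₁) ((hg _).mul_X_add_C c₂)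
      (hh _) (hh _) (congrArg Subtype.val heq)
    obtain rfl : c₁ = c₂ := by simpa using congrArg (coeff · 0) hG
    have hG' := mul_right_cancel₀ X_ne_zero (add_right_cancel hG)
    have hf : f₁ = f₂ := (hgh ⟨f₁, hf₁.1⟩).trans
      ((congrArg₂ (fun a b ↦ a ^ 2 * b) hG' hH).trans (hgh ⟨f₂, hf₂.1⟩).symm)
    subst hf
    rfl
  · rintro ⟨f, hf0, hsq, hdeg⟩
    obtain ⟨c, g', h', hg', hh', rfl⟩ := exists_eq_X_mul_add_C_sq_mul hf0 hsq
    have hne : g' ^ 2 * h' ≠ 0 := mul_ne_zero (pow_ne_zero 2 hg'.ne_zero) hh'.ne_zero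
    obtain ⟨hG, hH⟩ := sq_mul_squarefree_unique (hg ⟨_, hne⟩) hg' (hh ⟨_, hne⟩) hh'
      (hgh ⟨_, hne⟩).symm
    rw [natDegree_mul_X_add_C_sq_mul hg' hh'.ne_zero] at hdeg
    refine ⟨⟨c, g' ^ 2 * h', hne, by omega⟩, Subtype.ext ?_⟩
    simp only [Φ, hG, hH]

theorem card_squarefree_natDegree_le [Finite F] {d : ℕ} (hd : 1 ≤ d) :
    Nat.card {f : F[X] | f.natDegree ≤ d ∧ Squarefree f} =
      (Nat.card F - 1) * (Nat.card F ^ d + 1) := by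
  have hq : 1 ≤ Nat.card F := Nat.card_pos
  have card_ne_zero (n : ℕ) :
      Nat.card {f : F[X] | f ≠ 0 ∧ f.natDegree ≤ n} + 1 = Nat.card F ^ (n + 1) := by
    rw [← card_natDegree_le, Nat.card_coe_set_eq, Nat.card_coe_set_eq,
      ← Set.ncard_sdiff_singleton_add_one (a := (0 : F[X])) (s := {f : F[X] | f.natDegree ≤ n})
        (by simp) (finite_natDegree_le F n)]
    congr 2
    ext f
    simp [and_comm]
  have split : Nat.card {f : F[X] | f.natDegree ≤ d ∧ Squarefree f} +
      Nat.card {f : F[X] | f ≠ 0 ∧ ¬Squarefree f ∧ f.natDegree ≤ d} =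
      Nat.card {f : F[X] | f ≠ 0 ∧ f.natDegree ≤ d} := by
    simp only [Nat.card_coe_set_eq]
    rw [← Set.ncard_union_eq ?_ ((finite_natDegree_le F d).subset fun f hf ↦ hf.1)
      ((finite_natDegree_le F d).subset fun f hf ↦ hf.2.2)]
    · congr 1
      ext f
      have : Squarefree f → f ≠ 0 := Squarefree.ne_zero
      simp only [Set.mem_union, Set.mem_ofPred_eq]
      tauto
    · rw [Set.disjoint_left]
      exact fun f hf hf' ↦ hf'.2.1 hf.2
  have total := card_ne_zero d
  obtain ⟨q, hq'⟩ := Nat.exists_eq_add_of_le' hq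
  obtain rfl | ⟨e, rfl⟩ : d = 1 ∨ ∃ e, d = e + 2 := by
    rcases hd.eq_or_lt with h | h
    · exact Or.inl h.symm
    · exact Or.inr ⟨d - 2, by omega⟩
  · have hempty : {f : F[X] | f ≠ 0 ∧ ¬Squarefree f ∧ f.natDegree ≤ 1} = ∅ := by
      rw [Set.eq_empty_iff_forall_notMem]
      rintro f ⟨hf, hsq, hdeg⟩
      obtain ⟨c, g, h, hg, hh, rfl⟩ := exists_eq_X_mul_add_C_sq_mul hf hsq
      rw [natDegree_mul_X_add_C_sq_mul hg hh.ne_zero] at hdeg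
      omega
    rw [hempty, Nat.card_coe_set_eq ∅, Set.ncard_empty, add_zero] at split
    rw [split]
    rw [hq'] at total ⊢
    simp only [Nat.add_sub_cancel]
    exact Nat.add_right_cancel (total.trans (by ring))
  · rw [card_not_squarefree_natDegree_le] at split
    have total' := card_ne_zero e
    rw [hq'] at total total' split ⊢
    simp only [Nat.add_sub_cancel]
    have h1 : (q + 1) ^ (e + 2) = (q + 1) * (q + 1) ^ (e + 1) := pow_succ' _ _
    have h2 : (q + 1) ^ (e + 2 + 1) = (q + 1) * ((q + 1) * (q + 1) ^ (e + 1)) := by ring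
    rw [h2] at total
    rw [h1]
    generalize (q + 1) ^ (e + 1) = Q at *
    subst total'
    linarith

end Squarefree
end Polynomial

/-- The number of separable polynomials of degree at most `d ≥ 1` in `(ℤ/p^k)[x]`
(with arbitrary leading coefficient) is `φ(p^k)·p^((k-1)d)·(p^d + 1)`. -/
theorem count_separable_deg_le (p k d : ℕ) (hp : p.Prime) (hk : 1 ≤ k) (hd : 1 ≤ d) :
    Nat.card {f : (ZMod (p ^ k))[X] | f.natDegree ≤ d ∧ f.IsSeparablePoly}
      = Nat.totient (p ^ k) * p ^ ((k - 1) * d) * (p ^ d + 1) := by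
  have : Fact p.Prime := ⟨hp⟩
  have : NeZero (p ^ k) := ⟨pow_ne_zero k hp.ne_zero⟩
  obtain ⟨m, rfl⟩ := Nat.exists_eq_add_of_le' hk
  let φ : ZMod (p ^ (m + 1)) →+* ZMod p := ZMod.castHom (dvd_pow_self p (Nat.succ_ne_zero m)) _
  have hφ : Function.Surjective φ := ZMod.castHom_surjective _
  have hker : RingHom.ker φ ≤ nilradical (ZMod (p ^ (m + 1))) := by
    intro x hx
    obtain ⟨n, rfl⟩ := ZMod.natCast_zmod_surjective x
    rw [RingHom.mem_ker, map_natCast, ZMod.natCast_eq_zero_iff] at hx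
    refine mem_nilradical.mpr ⟨m + 1, ?_⟩
    rw [← Nat.cast_pow, ZMod.natCast_eq_zero_iff]
    exact pow_dvd_pow_of_dvd hx _
  have hsep (f : (ZMod (p ^ (m + 1)))[X]) : f.IsSeparablePoly ↔ Squarefree (f.map φ) := by
    rw [IsSeparablePoly, isSeparableAlgebra_iff_formallyUnramified,
      AdjoinRoot.formallyUnramified_iff_separable,
      ← separable_map_iff_of_ker_le_nilradical φ hφ hker, PerfectField.separable_iff_squarefree]
  have hcard := card_natDegree_le_map_mul φ hφ d Squarefree
  rw [card_squarefree_natDegree_le hd, Nat.card_zmod, Nat.card_zmod] at hcard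
  simp only [hsep]
  apply Nat.eq_of_mul_eq_mul_right (pow_pos hp.pos (d + 1))
  rw [hcard, Nat.totient_prime_pow_succ hp, Nat.add_sub_cancel]
  ring
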